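/- Let 𝕂 be a field of characteristic 0 and let q ∈ 𝕂 be invertible and not a root of unity. Let R = t𝕂[t] be the (nonunital) algebra of polynomials with zero constant term, and define the 𝕂-linear map P : R → R on monomials by P(tⁿ) = (qⁿ/(1−qⁿ)) tⁿ for n ≥ 1. Then P is a Rota–Baxter operator of weight 1 on R: P(x)P(y) = P(xP(y)) + P(P(x)y) + P(xy) for all x,y ∈ R. -/

import Mathlib

open Polynomial

/-- For `q` invertible and not a root of unity, the linear operator
`P` on `t𝕂[t]` (polynomials with zero constant term) determined on monomials by
`P(tⁿ) = (qⁿ/(1-qⁿ)) tⁿ` is a Rota–Baxter operator of weight 1. -/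
theorem statement16 (K : Type) [Field K] [CharZero K]
    (q : K) (hq0 : q ≠ 0) (hqru : ∀ n : ℕ, 1 ≤ n → q ^ n ≠ 1)
    (P : K[X] →ₗ[K] K[X])
    (hP : ∀ n : ℕ, 1 ≤ n → P (X ^ n) = (q ^ n / (1 - q ^ n)) • (X ^ n : K[X])) :
    ∀ x y : K[X], x.coeff 0 = 0 → y.coeff 0 = 0 →
      P x * P y = P (x * P y) + P (P x * y) + P (x * y) := by
  intro x y hx hy
  obtain ⟨x, rfl⟩ := X_dvd_iff.mpr hx
  obtain ⟨y, rfl⟩ := X_dvd_iff.mpr hy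
  clear hx hy
  induction x using Polynomial.induction_on' with
  | add x₁ x₂ h₁ h₂ =>
    simp only [mul_add, add_mul, map_add] at h₁ h₂ ⊢
    rw [h₁, h₂]; abel
  | monomial m a =>
    induction y using Polynomial.induction_on' with
    | add y₁ y₂ h₁ h₂ =>
      simp only [mul_add, map_add] at h₁ h₂ ⊢
      rw [h₁, h₂]; abel
    | monomial n b =>
      have e : ∀ (k : ℕ) (c : K), (X : K[X]) * monomial k c = c • X ^ (k + 1) := by
        intro k c
        rw [← C_mul_X_pow_eq_monomial, smul_eq_C_mul]; ring
      have h1 : 1 - q ^ (m + 1) ≠ 0 := sub_ne_zero.mpr (hqru _ (by omega)).symm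
      have h2 : 1 - q ^ (n + 1) ≠ 0 := sub_ne_zero.mpr (hqru _ (by omega)).symm
      have h3 : 1 - q ^ (m + 1 + (n + 1)) ≠ 0 := sub_ne_zero.mpr (hqru _ (by omega)).symm
      simp only [e, map_smul, hP (m + 1) (by omega), hP (n + 1) (by omega),
        smul_mul_assoc, mul_smul_comm, ← pow_add, hP (m + 1 + (n + 1)) (by omega),
        smul_smul, ← add_smul]
      congr 1
      rw [pow_add q (m + 1) (n + 1)] at h3 ⊢
      generalize q ^ (m + 1) = u at *
      generalize q ^ (n + 1) = v at *
      have h4 : 1 - v * u ≠ 0 := by rwa [mul_comm]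
      field_simp
      ring
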